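/- Let p, q be nonzero real numbers, and assume that the inequality Φ(A^p)^{1/p} ≤ Φ(A^q)^{1/q} holds for every unital completely positive linear map Φ : M₃ → M₂ and every 3×3 positive definite complex matrix A. Then (p, q) satisfies condition (★). -/

import Mathlib

open scoped ComplexOrder

/-- Real functional calculus for Hermitian complex matrices, via the spectral theorem
(junk value `0` for non-Hermitian matrices). -/
noncomputable def Matrix.cfcReal {n : Type*} [Fintype n] [DecidableEq n]
    (f : ℝ → ℝ) (A : Matrix n n ℂ) : Matrix n n ℂ :=
  if hA : A.IsHermitian then
    (hA.eigenvectorUnitary : Matrix n n ℂ) *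
      Matrix.diagonal (fun i => (f (hA.eigenvalues i) : ℂ)) *
      star (hA.eigenvectorUnitary : Matrix n n ℂ)
  else 0

/-- The real power `A ^ r` of a Hermitian (in particular, positive definite) matrix,
defined by functional calculus, with the conventions `0 ^ r = 0` for `r ≠ 0` and `x ^ 0 = 1`. -/
noncomputable def Matrix.rpowH {n : Type*} [Fintype n] [DecidableEq n]
    (A : Matrix n n ℂ) (r : ℝ) : Matrix n n ℂ :=
  Matrix.cfcReal (fun t => t ^ r) A

/-- The logarithm of a positive definite matrix, by functional calculus. -/
noncomputable def Matrix.logH {n : Type*} [Fintype n] [DecidableEq n]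
    (A : Matrix n n ℂ) : Matrix n n ℂ :=
  Matrix.cfcReal Real.log A

/-- The exponential of a Hermitian matrix, by functional calculus. -/
noncomputable def Matrix.expH {n : Type*} [Fintype n] [DecidableEq n]
    (A : Matrix n n ℂ) : Matrix n n ℂ :=
  Matrix.cfcReal Real.exp A

/-- Condition (★) on a pair `(p, q)` of real parameters. -/
def StarCond (p q : ℝ) : Prop :=
  p = q ∨ (1 ≤ p ∧ p < q) ∨ (p < q ∧ q ≤ -1) ∨ (p ≤ -1 ∧ 1 ≤ q) ∨
    (1/2 ≤ p ∧ p < 1 ∧ 1 ≤ q) ∨ (p ≤ -1 ∧ -1 < q ∧ q ≤ -1/2)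

/-- A linear map `Φ : Mₙ → Mₘ` (on complex matrices) is completely positive if for every
`k ∈ ℕ` the induced map `Φ ⊗ id : Mₙ ⊗ M_k → Mₘ ⊗ M_k` maps positive semidefinite matrices
to positive semidefinite matrices. -/
def IsCompletelyPositive {n m : ℕ}
    (Φ : Matrix (Fin n) (Fin n) ℂ →ₗ[ℂ] Matrix (Fin m) (Fin m) ℂ) : Prop :=
  ∀ (k : ℕ) (M : Matrix (Fin n × Fin k) (Fin n × Fin k) ℂ), M.PosSemidef →
    (Matrix.of fun (i j : Fin m × Fin k) =>
      Φ (Matrix.of fun s t => M (s, i.2) (t, j.2)) i.1 j.1).PosSemidef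

open scoped Topology
open Filter

/-- `G` of the first-order condition. -/
noncomputable def foG (p q a c : ℝ) : ℝ :=
  (c ^ q - a ^ q) * (a ^ (1 - q) / q) - (c ^ p - a ^ p) * (a ^ (1 - p) / p)

/-- `K` of the first-order condition. -/
noncomputable def foK (p q a b c : ℝ) : ℝ :=
  (a - b) / (a ^ q - b ^ q) * (c ^ q - b ^ q) - (a - b) / (a ^ p - b ^ p) * (c ^ p - b ^ p)

/-- first-order necessary condition. -/
def FO (p q : ℝ) : Prop :=
  ∀ a b c : ℝ, 0 < a → 0 < b → 0 < c → a ≠ b →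
    0 ≤ foG p q a c ∧ foK p q a b c ^ 2 ≤ foG p q a c * foG p q b c

theorem foG_inv (p q a c : ℝ) (ha : 0 < a) (hc : 0 < c) :
    foG p q a⁻¹ c⁻¹ = (a⁻¹) ^ 2 * foG (-q) (-p) a c := by
  have e : ∀ r : ℝ, (a⁻¹) ^ (1 - r) = (a⁻¹) ^ 2 * a ^ (1 - -r) := by
    intro r
    rw [Real.inv_rpow ha.le, ← Real.rpow_neg ha.le, inv_pow, ← Real.rpow_natCast,
      ← Real.rpow_neg ha.le, ← Real.rpow_add ha]
    congr 1; push_cast; ring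
  have e2 : ∀ r : ℝ, ∀ x : ℝ, 0 < x → (x⁻¹) ^ r = x ^ (-r) := by
    intro r x hx
    rw [Real.inv_rpow hx.le, Real.rpow_neg hx.le]
  unfold foG
  rw [e q, e p, e2 q c hc, e2 q a ha, e2 p c hc, e2 p a ha]
  rw [div_neg, div_neg]
  ring

theorem foK_inv (p q a b c : ℝ) (ha : 0 < a) (hb : 0 < b) (hc : 0 < c) :
    foK p q a⁻¹ b⁻¹ c⁻¹ = (a⁻¹ * b⁻¹) * foK (-q) (-p) a b c := by
  have e2 : ∀ r : ℝ, ∀ x : ℝ, 0 < x → (x⁻¹) ^ r = x ^ (-r) := by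
    intro r x hx
    rw [Real.inv_rpow hx.le, Real.rpow_neg hx.le]
  have e3 : a⁻¹ - b⁻¹ = - (a⁻¹ * b⁻¹ * (a - b)) := by
    field_simp; ring
  unfold foK
  rw [e2 q a ha, e2 q b hb, e2 q c hc, e2 p a ha, e2 p b hb, e2 p c hc, e3]
  ring

theorem FO.mirror {p q : ℝ} (h : FO p q) : FO (-q) (-p) := by
  intro a b c ha hb hc hab
  have := h a⁻¹ b⁻¹ c⁻¹ (inv_pos.2 ha) (inv_pos.2 hb) (inv_pos.2 hc) (fun h => hab (inv_injective h))
  rw [foG_inv p q a c ha hc, foG_inv p q b c hb hc, foK_inv p q a b c ha hb hc] at this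
  obtain ⟨h1, h2⟩ := this
  have pa : 0 < a⁻¹ ^ 2 := by positivity
  have pb : 0 < b⁻¹ ^ 2 := by positivity
  refine ⟨nonneg_of_mul_nonneg_right h1 pa, ?_⟩
  have : (a⁻¹ ^ 2 * b⁻¹ ^ 2) * foK (-q) (-p) a b c ^ 2 ≤
      (a⁻¹ ^ 2 * b⁻¹ ^ 2) * (foG (-q) (-p) a c * foG (-q) (-p) b c) := by
    nlinarith [h2]
  exact le_of_mul_le_mul_left this (by positivity)

theorem FO.le {p q : ℝ} (hp : p ≠ 0) (hq : q ≠ 0) (h : FO p q) : p ≤ q := by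
  by_contra! hlt
  have hd : ∀ x : ℝ, 0 < x → HasDerivAt (fun x : ℝ => (x ^ p - 1) / p - (x ^ q - 1) / q)
      (x ^ (p - 1) - x ^ (q - 1)) x := by
    intro x hx
    have h1 := ((Real.hasDerivAt_rpow_const (p := p) (Or.inl hx.ne')).sub_const 1).div_const p
    have h2 := ((Real.hasDerivAt_rpow_const (p := q) (Or.inl hx.ne')).sub_const 1).div_const q
    refine (h1.sub h2).congr_deriv ?_
    field_simp
  have hm : StrictMonoOn (fun x : ℝ => (x ^ p - 1) / p - (x ^ q - 1) / q) (Set.Ici 1) := by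
    apply strictMonoOn_of_deriv_pos (convex_Ici 1)
    · intro x hx
      exact (hd x (lt_of_lt_of_le one_pos hx)).continuousAt.continuousWithinAt
    · intro x hx
      rw [interior_Ici] at hx
      have hx' : (1:ℝ) < x := hx
      rw [(hd x (by linarith)).deriv]
      have := Real.rpow_lt_rpow_of_exponent_lt hx' (show q - 1 < p - 1 by linarith)
      linarith
  have h1 := hm (show (1:ℝ) ∈ Set.Ici 1 by simp) (show (2:ℝ) ∈ Set.Ici 1 by simp) (by norm_num)
  have h2 := (h 1 2 2 (by norm_num) (by norm_num) (by norm_num) (by norm_num)).1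
  simp only [foG, Real.one_rpow] at h1 h2
  simp only [sub_self, zero_div] at h1
  have : ((2:ℝ) ^ q - 1) * (1 / q) - (2 ^ p - 1) * (1 / p) =
    -(((2:ℝ) ^ p - 1) / p - (2 ^ q - 1) / q) := by ring
  linarith

theorem tendsto_rpow_zero {r : ℝ} (hr : 0 < r) :
    Tendsto (fun a : ℝ => a ^ r) (𝓝[>] 0) (𝓝 0) := by
  have := (Real.continuousAt_rpow_const 0 r (Or.inr hr.le)).tendsto
  rw [Real.zero_rpow hr.ne'] at this
  exact this.mono_left nhdsWithin_le_nhds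

theorem tendsto_id_zero : Tendsto (fun a : ℝ => a) (𝓝[>] 0) (𝓝 0) :=
  (tendsto_id).mono_left nhdsWithin_le_nhds

theorem tendsto_G1 {r : ℝ} (hr1 : r < 1) :
    Tendsto (fun a : ℝ => ((2:ℝ) ^ r - a ^ r) * (a ^ (1 - r) / r)) (𝓝[>] 0) (𝓝 0) := by
  have h1 : Tendsto (fun a : ℝ => (2:ℝ) ^ r * (a ^ (1 - r) / r) - a / r) (𝓝[>] 0)
      (𝓝 ((2:ℝ) ^ r * (0 / r) - 0 / r)) :=
    (((tendsto_rpow_zero (by linarith)).div_const r).const_mul _).sub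
      (tendsto_id_zero.div_const r)
  simp only [zero_div, mul_zero, sub_zero] at h1
  refine h1.congr' ?_
  filter_upwards [self_mem_nhdsWithin] with a ha
  have ha : 0 < a := ha
  have : a ^ r * a ^ (1 - r) = a := by
    rw [← Real.rpow_add ha]; simp
  linear_combination (1/r) * this

theorem FO.S1 {p q : ℝ} (hp : p ≠ 0) (hpq : p < q) (h : FO p q) : ¬ (0 < q ∧ q < 1) := by
  rintro ⟨hq0, hq1⟩
  have hG : Tendsto (fun a => foG p q a 2) (𝓝[>] 0) (𝓝 (0 - 0)) :=
    (tendsto_G1 hq1).sub (tendsto_G1 (hpq.trans hq1))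
  have hpos : ∀ r : ℝ, 0 < r → Tendsto (fun a : ℝ => (a - 1) / (a ^ r - (1:ℝ) ^ r) * ((2:ℝ) ^ r - (1:ℝ) ^ r))
      (𝓝[>] 0) (𝓝 ((0 - 1) / (0 - (1:ℝ) ^ r) * ((2:ℝ) ^ r - (1:ℝ) ^ r))) := by
    intro r hr
    refine Tendsto.mul_const _ (Tendsto.div (tendsto_id_zero.sub_const 1)
      ((tendsto_rpow_zero hr).sub_const _) (by simp))
  have hK : ∃ L : ℝ, L < 2 ^ q - 1 ∧ Tendsto (fun a : ℝ => (a - 1) / (a ^ p - (1:ℝ) ^ p) * ((2:ℝ) ^ p - (1:ℝ) ^ p))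
      (𝓝[>] 0) (𝓝 L) := by
    rcases lt_or_gt_of_ne hp with hneg | hp0
    · refine ⟨0, ?_, ?_⟩
      · have := Real.one_lt_rpow (x := 2) (by norm_num) hq0
        linarith
      · have hinf : Tendsto (fun a : ℝ => a ^ p - (1:ℝ) ^ p) (𝓝[>] 0) atTop := by
          apply tendsto_atTop_add_const_right
          have h1 := (tendsto_rpow_neg_nhdsGT_zero hneg)
          exact h1
        have := (Tendsto.div_atTop (tendsto_id_zero.sub_const 1) hinf).mul_const ((2:ℝ) ^ p - (1:ℝ) ^ p)
        simpa using this
    · refine ⟨_, ?_, hpos p hp0⟩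
      have := Real.rpow_lt_rpow_of_exponent_lt (x := 2) (by norm_num) hpq
      simp
      linarith
  obtain ⟨L, hL, hKp⟩ := hK
  have hK := (hpos q hq0).sub hKp
  have hle : ∀ᶠ a : ℝ in 𝓝[>] 0, foK p q a 1 2 ^ 2 ≤ foG p q a 2 * foG p q 1 2 := by
    have h1 : ∀ᶠ a : ℝ in 𝓝[>] 0, a < 1 := nhdsWithin_le_nhds (eventually_lt_nhds one_pos)
    filter_upwards [self_mem_nhdsWithin, h1] with a ha ha1
    exact (h a 1 2 ha one_pos two_pos ha1.ne).2
  have := le_of_tendsto_of_tendsto (hK.pow 2) (hG.mul_const (foG p q 1 2)) hle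
  simp at this
  nlinarith

theorem FO.S2 {p q : ℝ} (hpq : p < q) (h : FO p q) : ¬ (0 < p ∧ p < 1 / 2) := by
  rintro ⟨hp0, hp1⟩
  have hq0 := hp0.trans hpq
  have key : ∀ b : ℝ, 0 < b → b < 1 →
      ((1 - b) * (1 / (1 - b ^ p) - b ^ (q - p) / (1 - b ^ q))) ^ 2 ≤
        (1 / p - 1 / q) ^ 2 * b ^ (1 - 2 * p) := by
    intro b hb hb1
    have hG : ∀ a : ℝ, 0 < a → Tendsto (fun c => foG p q a c) (𝓝[>] 0) (𝓝 (a * (1 / p - 1 / q))) := by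
      intro a ha
      have := (((tendsto_rpow_zero hq0).sub_const (a ^ q)).mul_const (a ^ (1 - q) / q)).sub
        (((tendsto_rpow_zero hp0).sub_const (a ^ p)).mul_const (a ^ (1 - p) / p))
      refine (show Tendsto (fun c => foG p q a c) _ _ from this).trans (le_of_eq ?_)
      congr 1
      have e1 : a ^ q * a ^ (1 - q) = a := by rw [← Real.rpow_add ha]; simp
      have e2 : a ^ p * a ^ (1 - p) = a := by rw [← Real.rpow_add ha]; simp
      linear_combination (-1 / q) * e1 + (1 / p) * e2
    have hK := ((((tendsto_rpow_zero hq0).sub_const (b ^ q)).const_mul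
        ((1 - b) / ((1:ℝ) ^ q - b ^ q))).sub
        (((tendsto_rpow_zero hp0).sub_const (b ^ p)).const_mul
        ((1 - b) / ((1:ℝ) ^ p - b ^ p)))).pow 2
    have hle : ∀ᶠ c : ℝ in 𝓝[>] 0, foK p q 1 b c ^ 2 ≤ foG p q 1 c * foG p q b c := by
      filter_upwards [self_mem_nhdsWithin] with c hc
      exact (h 1 b c one_pos hb hc hb1.ne').2
    have h3 := le_of_tendsto_of_tendsto hK ((hG 1 one_pos).mul (hG b hb)) hle
    have e1 : b ^ q = b ^ (q - p) * b ^ p := by rw [← Real.rpow_add hb]; simp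
    have e2 : b = b ^ (1 - 2 * p) * (b ^ p) ^ 2 := by
      rw [← Real.rpow_natCast, ← Real.rpow_mul hb.le, ← Real.rpow_add hb]
      push_cast
      rw [show 1 - 2 * p + p * 2 = 1 by ring, Real.rpow_one]
    have hbp : 0 < (b ^ p) ^ 2 := by positivity
    simp only [Real.one_rpow] at h3
    have l : ((1 - b) / (1 - b ^ q) * (0 - b ^ q) - (1 - b) / (1 - b ^ p) * (0 - b ^ p)) =
      ((1 - b) * (1 / (1 - b ^ p) - b ^ (q - p) / (1 - b ^ q))) * b ^ p := by
      have : (1 - b) / (1 - b ^ q) * (0 - b ^ q) = (1 - b) / (1 - b ^ q) * (0 - b ^ (q - p) * b ^ p) := by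
        rw [← e1]
      rw [this]; ring
    have r : 1 * (1 / p - 1 / q) * (b * (1 / p - 1 / q)) =
        ((1 / p - 1 / q) ^ 2 * b ^ (1 - 2 * p)) * (b ^ p) ^ 2 := by
      linear_combination (1 / p - 1 / q) ^ 2 * e2
    rw [l, r, mul_pow] at h3
    exact le_of_mul_le_mul_right h3 hbp
  have hl : Tendsto (fun b : ℝ => ((1 - b) * (1 / (1 - b ^ p) - b ^ (q - p) / (1 - b ^ q))) ^ 2)
      (𝓝[>] 0) (𝓝 (((1 - 0) * (1 / (1 - 0) - 0 / (1 - 0))) ^ 2)) := by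
    refine Tendsto.pow (Tendsto.mul (tendsto_id_zero.const_sub 1) (Tendsto.sub
      (Tendsto.div tendsto_const_nhds ((tendsto_rpow_zero hp0).const_sub 1) (by norm_num))
      (Tendsto.div (tendsto_rpow_zero (by linarith)) ((tendsto_rpow_zero hq0).const_sub 1)
        (by norm_num)))) 2
  have hr := (tendsto_rpow_zero (show 0 < 1 - 2 * p by linarith)).const_mul ((1 / p - 1 / q) ^ 2)
  have := le_of_tendsto_of_tendsto hl hr (by
    have h1 : ∀ᶠ a : ℝ in 𝓝[>] 0, a < 1 := nhdsWithin_le_nhds (eventually_lt_nhds one_pos)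
    filter_upwards [self_mem_nhdsWithin, h1] with b hb hb1
    exact key b hb hb1)
  norm_num at this

theorem FO.star {p q : ℝ} (hp : p ≠ 0) (hq : q ≠ 0) (h : FO p q) : StarCond p q := by
  have hle := h.le hp hq
  rcases hle.eq_or_lt with rfl | hlt
  · exact Or.inl rfl
  have h1 := h.S1 hp hlt
  have h2 := h.S2 hlt
  have h3 := h.mirror.S1 (neg_ne_zero.2 hq) (neg_lt_neg hlt)
  have h4 := h.mirror.S2 (neg_lt_neg hlt)
  unfold StarCond
  right
  rcases lt_or_gt_of_ne hp with hp' | hp'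
  · have : p ≤ -1 := by
      by_contra! hh; exact h3 ⟨by linarith, by linarith⟩
    rcases lt_or_gt_of_ne hq with hq' | hq'
    · have : q ≤ -1/2 := by
        by_contra! hh; exact h4 ⟨by linarith, by linarith⟩
      rcases le_or_gt q (-1) with h5 | h5
      · exact Or.inr (Or.inl ⟨hlt, h5⟩)
      · exact Or.inr (Or.inr (Or.inr (Or.inr ⟨by assumption, h5, this⟩)))
    · have : 1 ≤ q := by
        by_contra! hh; exact h1 ⟨by linarith, by linarith⟩
      exact Or.inr (Or.inr (Or.inl ⟨by assumption, this⟩))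
  · have h5 : 1/2 ≤ p := by
      by_contra! hh; exact h2 ⟨by linarith, by linarith⟩
    have h6 : 1 ≤ q := by
      by_contra! hh; exact h1 ⟨by linarith, by linarith⟩
    rcases le_or_gt 1 p with h7 | h7
    · exact Or.inl ⟨h7, hlt⟩
    · exact Or.inr (Or.inr (Or.inr (Or.inl ⟨h5, h7, h6⟩)))

theorem cfcReal_diagonal (f : ℝ → ℝ) (d : Fin 3 → ℝ) :
    Matrix.cfcReal f (Matrix.diagonal (fun i => (d i : ℂ))) =
      Matrix.diagonal (fun i => (f (d i) : ℂ)) := by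
  have hA : (Matrix.diagonal (fun i => (d i : ℂ))).IsHermitian := by
    rw [Matrix.isHermitian_diagonal_iff]
    intro i
    exact Complex.conj_ofReal _
  rw [Matrix.cfcReal, dif_pos hA]
  set U := hA.eigenvectorUnitary with hU
  have hs := hA.spectral_theorem
  rw [Unitary.conjStarAlgAut_apply] at hs
  have hUU : star (U : Matrix (Fin 3) (Fin 3) ℂ) * U = 1 := Unitary.coe_star_mul_self U
  have hUU' : (U : Matrix (Fin 3) (Fin 3) ℂ) * star (U : Matrix (Fin 3) (Fin 3) ℂ) = 1 :=
    Unitary.coe_mul_star_self U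
  have h1 : Matrix.diagonal (fun i => (d i : ℂ)) * (U : Matrix (Fin 3) (Fin 3) ℂ) =
      U * Matrix.diagonal (fun i => (hA.eigenvalues i : ℂ)) := by
    calc _ = (U : Matrix (Fin 3) (Fin 3) ℂ) * Matrix.diagonal (fun i => (hA.eigenvalues i : ℂ))
        * star (U : Matrix (Fin 3) (Fin 3) ℂ) * U := by
          congr 1
      _ = _ := by rw [Matrix.mul_assoc, hUU, Matrix.mul_one]
  have h2 : Matrix.diagonal (fun i => (f (d i) : ℂ)) * (U : Matrix (Fin 3) (Fin 3) ℂ) =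
      U * Matrix.diagonal (fun i => (f (hA.eigenvalues i) : ℂ)) := by
    ext i j
    have := congrFun (congrFun h1 i) j
    rw [Matrix.diagonal_mul, Matrix.mul_diagonal] at this ⊢
    by_cases h0 : (U : Matrix (Fin 3) (Fin 3) ℂ) i j = 0
    · simp [h0]
    · have h3 : (d i : ℂ) = hA.eigenvalues j := by
        rw [mul_comm] at this
        exact mul_left_cancel₀ h0 this
      have h4 : d i = hA.eigenvalues j := by exact_mod_cast h3
      rw [h4, mul_comm]
  rw [← h2, Matrix.mul_assoc, hUU', Matrix.mul_one]

/-- real symmetric 2x2 matrix -/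
noncomputable def sym2 (x y z : ℝ) : Matrix (Fin 2) (Fin 2) ℂ :=
  !![(x : ℂ), (y : ℂ); (y : ℂ), (z : ℂ)]

theorem sym2_herm (x y z : ℝ) : (sym2 x y z).IsHermitian := by
  ext i j
  fin_cases i <;> fin_cases j <;> simp [sym2]

theorem cfcReal_sym2 (f : ℝ → ℝ) (x y z δ : ℝ) (hδ : δ ^ 2 + δ * (x - z) = y ^ 2)
    (hne : x + δ ≠ z - δ) :
    Matrix.cfcReal f (sym2 x y z) =
      sym2 (f (x + δ) - (f (x + δ) - f (z - δ)) / ((x + δ) - (z - δ)) * δ)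
        ((f (x + δ) - f (z - δ)) / ((x + δ) - (z - δ)) * y)
        (f (z - δ) + (f (x + δ) - f (z - δ)) / ((x + δ) - (z - δ)) * δ) := by
  have hA := sym2_herm x y z
  rw [Matrix.cfcReal, dif_pos hA]
  set U := hA.eigenvectorUnitary with hU
  have hs := hA.spectral_theorem
  rw [Unitary.conjStarAlgAut_apply] at hs
  have hUU' : (U : Matrix (Fin 2) (Fin 2) ℂ) * star (U : Matrix (Fin 2) (Fin 2) ℂ) = 1 :=
    Unitary.coe_mul_star_self U
  set β := (f (x + δ) - f (z - δ)) / ((x + δ) - (z - δ)) with hβ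
  have hβ' : β * ((x + δ) - (z - δ)) = f (x + δ) - f (z - δ) := by
    rw [hβ]; exact div_mul_cancel₀ _ (sub_ne_zero.2 hne)
  have htr := hA.trace_eq_sum_eigenvalues
  have hdet := hA.det_eq_prod_eigenvalues
  have htr' : hA.eigenvalues 0 + hA.eigenvalues 1 = x + z := by
    simp [Fin.sum_univ_two, sym2, Matrix.trace] at htr
    exact_mod_cast htr.symm
  have hdet' : hA.eigenvalues 0 * hA.eigenvalues 1 = x * z - y * y := by
    simp [Fin.prod_univ_two, sym2, Matrix.det_fin_two] at hdet
    exact_mod_cast hdet.symm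
  have hroot : ∀ i, (hA.eigenvalues i - (x + δ)) * (hA.eigenvalues i - (z - δ)) = 0 := by
    intro i
    fin_cases i
    · show (hA.eigenvalues 0 - (x + δ)) * (hA.eigenvalues 0 - (z - δ)) = 0
      linear_combination hA.eigenvalues 0 * htr' - hdet' - hδ
    · show (hA.eigenvalues 1 - (x + δ)) * (hA.eigenvalues 1 - (z - δ)) = 0
      linear_combination hA.eigenvalues 1 * htr' - hdet' - hδ
  have hf : ∀ i, f (hA.eigenvalues i) = (f (x + δ) - β * (x + δ)) + β * hA.eigenvalues i := by
    intro i
    rcases mul_eq_zero.1 (hroot i) with h | h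
    · have : hA.eigenvalues i = x + δ := by linarith
      rw [this]; ring
    · have : hA.eigenvalues i = z - δ := by linarith
      rw [this]; linear_combination hβ'
  have hd : Matrix.diagonal (fun i => (f (hA.eigenvalues i) : ℂ)) =
      ((f (x + δ) - β * (x + δ) : ℝ) : ℂ) • (1 : Matrix (Fin 2) (Fin 2) ℂ) +
        (β : ℂ) • Matrix.diagonal (fun i => (hA.eigenvalues i : ℂ)) := by
    ext i j
    by_cases hij : i = j
    · subst hij
      simp [hf]
    · simp [hij]
  have hs' : (U : Matrix (Fin 2) (Fin 2) ℂ) * Matrix.diagonal (fun i => (hA.eigenvalues i : ℂ))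
        * star (U : Matrix (Fin 2) (Fin 2) ℂ) = sym2 x y z := hs.symm
  rw [hd, Matrix.mul_add, Matrix.add_mul, Matrix.mul_smul, Matrix.mul_smul, Matrix.smul_mul,
    Matrix.smul_mul, hs', Matrix.mul_one, hUU']
  have hβc : (β : ℂ) * ((x + δ) - (z - δ)) = f (x + δ) - f (z - δ) := by exact_mod_cast hβ'
  ext i j
  fin_cases i <;> fin_cases j <;> simp [sym2]
  · ring
  · linear_combination -hβc

theorem exists_delta (w y : ℝ) : ∃ δ : ℝ, δ ^ 2 + δ * w = y ^ 2 ∧ 0 ≤ δ * w := by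
  have hs := Real.sq_sqrt (show 0 ≤ w ^ 2 + 4 * y ^ 2 by positivity)
  have hs0 := Real.sqrt_nonneg (w ^ 2 + 4 * y ^ 2)
  have hw : |w| ≤ Real.sqrt (w ^ 2 + 4 * y ^ 2) := by
    apply Real.abs_le_sqrt; nlinarith [sq_nonneg y]
  rcases le_total 0 w with h | h
  · refine ⟨(-w + Real.sqrt (w ^ 2 + 4 * y ^ 2)) / 2, ?_, ?_⟩
    · nlinarith
    · rw [abs_of_nonneg h] at hw
      apply mul_nonneg _ h; linarith
  · refine ⟨(-w - Real.sqrt (w ^ 2 + 4 * y ^ 2)) / 2, ?_, ?_⟩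
    · nlinarith
    · rw [abs_of_nonpos h] at hw
      apply mul_nonneg_of_nonpos_of_nonpos _ h; linarith

theorem sym2_posSemidef_iff (x y z : ℝ) :
    (sym2 x y z).PosSemidef ↔ 0 ≤ x ∧ 0 ≤ z ∧ y ^ 2 ≤ x * z := by
  constructor
  · intro h
    have h1 := h.diag_nonneg (i := 0)
    have h2 := h.diag_nonneg (i := 1)
    have h3 := h.det_nonneg
    simp [sym2, Matrix.det_fin_two] at h1 h2 h3
    refine ⟨h1, h2, ?_⟩
    have : (y:ℂ) * y ≤ x * z := h3
    have h4 : y * y ≤ x * z := by exact_mod_cast this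
    nlinarith
  · rintro ⟨hx, hz, hy⟩
    refine Matrix.PosSemidef.of_dotProduct_mulVec_nonneg (sym2_herm x y z) ?_
    intro v
    have hre : star v ⬝ᵥ (sym2 x y z).mulVec v =
      ((x * Complex.normSq (v 0) + z * Complex.normSq (v 1) +
        2 * y * ((v 0).re * (v 1).re + (v 0).im * (v 1).im) : ℝ) : ℂ) := by
      simp [sym2, Matrix.mulVec, dotProduct, Fin.sum_univ_two]
      apply Complex.ext <;> simp [Complex.normSq_apply] <;> ring
    rw [hre]
    rw [Complex.zero_le_real]
    simp only [Complex.normSq_apply]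
    have aux : ∀ s t : ℝ, 0 ≤ x * (s * s) + z * (t * t) + 2 * y * (s * t) := by
      intro s t
      rcases hx.eq_or_lt with h0 | h0
      · have : y = 0 := by
          have : y ^ 2 ≤ 0 := by rw [← h0] at hy; simpa using hy
          nlinarith
        subst this
        have := mul_nonneg hz (mul_self_nonneg t)
        rw [← h0]; nlinarith
      · have h5 : 0 ≤ x * (x * (s * s) + z * (t * t) + 2 * y * (s * t)) := by
          nlinarith [sq_nonneg (x * s + y * t), mul_nonneg (sub_nonneg.2 hy) (mul_self_nonneg t)]
        exact nonneg_of_mul_nonneg_right h5 h0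
    nlinarith [aux (v 0).re (v 1).re, aux (v 0).im (v 1).im]

/-- the map `X ↦ ∑ X i i • E i`. -/
noncomputable def povm (E : Fin 3 → Matrix (Fin 2) (Fin 2) ℂ) :
    Matrix (Fin 3) (Fin 3) ℂ →ₗ[ℂ] Matrix (Fin 2) (Fin 2) ℂ where
  toFun X := ∑ i, X i i • E i
  map_add' X Y := by simp [add_smul, Finset.sum_add_distrib]
  map_smul' c X := by simp [Finset.smul_sum, mul_smul]

theorem povm_cp (E : Fin 3 → Matrix (Fin 2) (Fin 2) ℂ) (hE : ∀ i, (E i).PosSemidef) :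
    IsCompletelyPositive (povm E) := by
  intro k M hM
  have : (Matrix.of fun (i j : Fin 2 × Fin k) =>
      povm E (Matrix.of fun s t => M (s, i.2) (t, j.2)) i.1 j.1) =
      ∑ l, Matrix.kroneckerMap (· * ·) (E l) (M.submatrix (fun a => (l, a)) (fun a => (l, a))) := by
    ext i j
    simp [povm, Fin.sum_univ_three, mul_comm]
  rw [this]
  apply Matrix.posSemidef_sum
  intro l _
  exact (hE l).kronecker (hM.submatrix _)

theorem povm_ineq {p q : ℝ} (h : ∀ Φ : Matrix (Fin 3) (Fin 3) ℂ →ₗ[ℂ] Matrix (Fin 2) (Fin 2) ℂ,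
      Φ 1 = 1 → IsCompletelyPositive Φ →
      ∀ A : Matrix (Fin 3) (Fin 3) ℂ, A.PosDef →
        (Matrix.rpowH (Φ (Matrix.rpowH A q)) (1 / q) -
          Matrix.rpowH (Φ (Matrix.rpowH A p)) (1 / p)).PosSemidef)
    (a b c ε : ℝ) (ha : 0 < a) (hb : 0 < b) (hc : 0 < c) (hε : 0 < ε) (hε2 : ε < 1 / 2) :
    (Matrix.rpowH (sym2 (a ^ q * (1 - ε - 2 * ε ^ 2) + b ^ q * (2 * ε ^ 2) + c ^ q * ε)
        (ε * (c ^ q - b ^ q)) (b ^ q * (1 - ε) + c ^ q * ε)) (1 / q) -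
      Matrix.rpowH (sym2 (a ^ p * (1 - ε - 2 * ε ^ 2) + b ^ p * (2 * ε ^ 2) + c ^ p * ε)
        (ε * (c ^ p - b ^ p)) (b ^ p * (1 - ε) + c ^ p * ε)) (1 / p)).PosSemidef := by
  let E : Fin 3 → Matrix (Fin 2) (Fin 2) ℂ :=
    ![sym2 (1 - ε - 2 * ε ^ 2) 0 0, sym2 (2 * ε ^ 2) (-ε) (1 - ε), sym2 ε ε ε]
  let d : Fin 3 → ℝ := ![a, b, c]
  have hE : ∀ i, (E i).PosSemidef := by
    intro i
    fin_cases i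
    · show (sym2 (1 - ε - 2 * ε ^ 2) 0 0).PosSemidef
      rw [sym2_posSemidef_iff]
      refine ⟨by nlinarith, le_rfl, by simp⟩
    · show (sym2 (2 * ε ^ 2) (-ε) (1 - ε)).PosSemidef
      rw [sym2_posSemidef_iff]
      refine ⟨by positivity, by linarith, by nlinarith [sq_nonneg ε]⟩
    · show (sym2 ε ε ε).PosSemidef
      rw [sym2_posSemidef_iff]
      refine ⟨hε.le, hε.le, by nlinarith⟩
  have h1 : povm E 1 = 1 := by
    ext i j
    fin_cases i <;> fin_cases j <;> simp [povm, E, Fin.sum_univ_three, sym2]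
  have hA : (Matrix.diagonal (fun i => (d i : ℂ))).PosDef := by
    apply Matrix.PosDef.diagonal
    intro i
    fin_cases i <;> simp [d, ha, hb, hc]
  have key := h (povm E) h1 (povm_cp E hE) _ hA
  have hr : ∀ r : ℝ, povm E (Matrix.rpowH (Matrix.diagonal (fun i => (d i : ℂ))) r) =
      sym2 (a ^ r * (1 - ε - 2 * ε ^ 2) + b ^ r * (2 * ε ^ 2) + c ^ r * ε)
        (ε * (c ^ r - b ^ r)) (b ^ r * (1 - ε) + c ^ r * ε) := by
    intro r
    rw [Matrix.rpowH, cfcReal_diagonal]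
    ext i j
    fin_cases i <;> fin_cases j <;> simp [povm, E, d, Fin.sum_univ_three, sym2] <;> ring
  rw [hr, hr] at key
  exact key

/-- Expansion of the power of the explicit curve. -/
theorem curve_expansion (r a b c : ℝ) (hr : r ≠ 0) (ha : 0 < a) (hb : 0 < b)
    (hab : a ≠ b) : ∃ X Y Z : ℝ → ℝ,
      X 0 = a ∧ Y 0 = 0 ∧ Z 0 = b ∧
      HasDerivAt X ((c ^ r - a ^ r) * (a ^ (1 - r) / r)) 0 ∧
      HasDerivAt Y ((a - b) / (a ^ r - b ^ r) * (c ^ r - b ^ r)) 0 ∧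
      HasDerivAt Z ((c ^ r - b ^ r) * (b ^ (1 - r) / r)) 0 ∧
      ∀ᶠ ε in 𝓝 (0:ℝ), Matrix.rpowH
        (sym2 (a ^ r * (1 - ε - 2 * ε ^ 2) + b ^ r * (2 * ε ^ 2) + c ^ r * ε)
        (ε * (c ^ r - b ^ r)) (b ^ r * (1 - ε) + c ^ r * ε)) (1 / r) =
        sym2 (X ε) (Y ε) (Z ε) := by
  set x : ℝ → ℝ := fun ε => a ^ r * (1 - ε - 2 * ε ^ 2) + b ^ r * (2 * ε ^ 2) + c ^ r * ε with hx
  set y : ℝ → ℝ := fun ε => ε * (c ^ r - b ^ r) with hy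
  set z : ℝ → ℝ := fun ε => b ^ r * (1 - ε) + c ^ r * ε with hz
  choose δ hδ1 hδ2 using fun ε => exists_delta (x ε - z ε) (y ε)
  have hx0 : x 0 = a ^ r := by simp [hx]
  have hz0 : z 0 = b ^ r := by simp [hz]
  have hy0 : y 0 = 0 := by simp [hy]
  have hne : a ^ r - b ^ r ≠ 0 := by
    intro h0
    apply hab
    have h1 : a ^ r = b ^ r := by linarith
    exact (Real.rpow_left_inj ha.le hb.le hr).1 h1
  have hδ0 : δ 0 = 0 := by
    have h1 := hδ1 0
    have h2 := hδ2 0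
    rw [hy0] at h1
    nlinarith [sq_nonneg (δ 0)]
  have hdx : HasDerivAt x (c ^ r - a ^ r) 0 := by
    have h1 := (((((hasDerivAt_id (0:ℝ)).const_sub 1).sub (((hasDerivAt_id (0:ℝ)).pow 2).const_mul 2)).const_mul (a ^ r)).add
      ((((hasDerivAt_id (0:ℝ)).pow 2).const_mul 2).const_mul (b ^ r))).add
      ((hasDerivAt_id (0:ℝ)).const_mul (c ^ r))
    refine h1.congr_deriv ?_
    simp; ring
  have hdy : HasDerivAt y (c ^ r - b ^ r) 0 := by
    have h1 := (hasDerivAt_id (0:ℝ)).mul_const (c ^ r - b ^ r)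
    refine h1.congr_deriv ?_
    simp
  have hdz : HasDerivAt z (c ^ r - b ^ r) 0 := by
    have h1 := ((((hasDerivAt_id (0:ℝ)).const_sub 1)).const_mul (b ^ r)).add
      ((hasDerivAt_id (0:ℝ)).const_mul (c ^ r))
    refine h1.congr_deriv ?_
    simp; ring
  have hdδ : HasDerivAt δ 0 0 := by
    have hw : Tendsto (fun ε => |x ε - z ε|) (𝓝 0) (𝓝 |a ^ r - b ^ r|) := by
      have := (hdx.continuousAt.sub hdz.continuousAt).abs.tendsto
      simpa [hx0, hz0] using this
    have hpos : 0 < |a ^ r - b ^ r| := abs_pos.2 hne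
    have hev := hw.eventually (lt_mem_nhds (half_lt_self hpos))
    have hO : δ =O[𝓝 0] (fun ε : ℝ => ε ^ 2) := by
      apply Asymptotics.IsBigO.of_bound ((c ^ r - b ^ r) ^ 2 / (|a ^ r - b ^ r| / 2))
      filter_upwards [hev] with ε he
      rw [Real.norm_eq_abs, Real.norm_eq_abs, abs_of_nonneg (sq_nonneg ε), div_mul_eq_mul_div,
        le_div_iff₀ (half_pos hpos)]
      calc |δ ε| * (|a ^ r - b ^ r| / 2) ≤ |δ ε| * |x ε - z ε| := by gcongr
        _ = δ ε * (x ε - z ε) := by rw [← abs_mul, abs_of_nonneg (hδ2 ε)]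
        _ ≤ (y ε) ^ 2 := by nlinarith [hδ1 ε, sq_nonneg (δ ε)]
        _ = _ := by rw [hy]; ring
    rw [hasDerivAt_iff_isLittleO]
    simp only [hδ0, sub_zero, smul_zero]
    refine hO.trans_isLittleO ?_
    exact Asymptotics.isLittleO_pow_id (by norm_num)
  have hl : HasDerivAt (fun ε => x ε + δ ε) (c ^ r - a ^ r) 0 := by
    exact (hdx.add hdδ).congr_deriv (add_zero _)
  have hm : HasDerivAt (fun ε => z ε - δ ε) (c ^ r - b ^ r) 0 := by
    exact (hdz.sub hdδ).congr_deriv (sub_zero _)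
  have inv : ∀ t : ℝ, 0 < t → (t ^ r) ^ (1 / r) = t := by
    intro t ht
    rw [← Real.rpow_mul ht.le, mul_one_div_cancel hr, Real.rpow_one]
  have invd : ∀ t : ℝ, 0 < t → 1 / r * (t ^ r) ^ (1 / r - 1) = t ^ (1 - r) / r := by
    intro t ht
    rw [← Real.rpow_mul ht.le, show r * (1 / r - 1) = 1 - r by field_simp]
    ring
  have hfl : HasDerivAt (fun ε => (x ε + δ ε) ^ (1 / r)) ((c ^ r - a ^ r) * (a ^ (1 - r) / r)) 0 := by
    have h1 := hl.rpow_const (p := 1 / r) (Or.inl (by rw [hx0, hδ0, add_zero]; positivity))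
    refine h1.congr_deriv ?_
    rw [hx0, hδ0, add_zero, mul_assoc, invd a ha]
  have hfm : HasDerivAt (fun ε => (z ε - δ ε) ^ (1 / r)) ((c ^ r - b ^ r) * (b ^ (1 - r) / r)) 0 := by
    have h1 := hm.rpow_const (p := 1 / r) (Or.inl (by rw [hz0, hδ0, sub_zero]; positivity))
    refine h1.congr_deriv ?_
    rw [hz0, hδ0, sub_zero, mul_assoc, invd b hb]
  have hden : (x 0 + δ 0) - (z 0 - δ 0) ≠ 0 := by
    rw [hx0, hz0, hδ0]; simpa using hne
  have hβ := (hfl.sub hfm).div (hl.sub hm) hden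
  set β : ℝ → ℝ := fun ε => ((x ε + δ ε) ^ (1 / r) - (z ε - δ ε) ^ (1 / r)) /
    ((x ε + δ ε) - (z ε - δ ε)) with hβdef
  have hβ0 : β 0 = (a - b) / (a ^ r - b ^ r) := by
    simp only [hβdef, hx0, hz0, hδ0, add_zero, sub_zero, inv a ha, inv b hb]
  have hβ' : ∃ β', HasDerivAt β β' 0 := ⟨_, hβ⟩
  obtain ⟨β', hβ''⟩ := hβ'
  refine ⟨fun ε => (x ε + δ ε) ^ (1 / r) - β ε * δ ε, fun ε => β ε * y ε,
    fun ε => (z ε - δ ε) ^ (1 / r) + β ε * δ ε, ?_, ?_, ?_, ?_, ?_, ?_, ?_⟩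
  · simp only [hx0, hδ0, add_zero, mul_zero, sub_zero, inv a ha]
  · simp only [hy0, mul_zero]
  · simp only [hz0, hδ0, add_zero, mul_zero, sub_zero, inv b hb]
  · refine (hfl.sub (hβ''.mul hdδ)).congr_deriv ?_
    simp [hδ0]
  · refine (hβ''.mul hdy).congr_deriv ?_
    rw [hy0, hβ0]; ring
  · refine (hfm.add (hβ''.mul hdδ)).congr_deriv ?_
    simp [hδ0]
  · have hcont := (hl.sub hm).continuousAt.eventually_ne hden
    filter_upwards [hcont] with ε he
    exact cfcReal_sym2 (fun t => t ^ (1 / r)) (x ε) (y ε) (z ε) (δ ε) (hδ1 ε) (sub_ne_zero.1 he)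

theorem tendsto_div_of_deriv {f : ℝ → ℝ} {f' : ℝ} (h0 : f 0 = 0) (hf : HasDerivAt f f' 0) :
    Tendsto (fun ε => f ε / ε) (𝓝[>] 0) (𝓝 f') := by
  have := hf.tendsto_slope_zero_right
  refine this.congr ?_
  intro t
  simp [h0, div_eq_inv_mul]

theorem FO_of_h {p q : ℝ} (hp : p ≠ 0) (hq : q ≠ 0)
    (h : ∀ Φ : Matrix (Fin 3) (Fin 3) ℂ →ₗ[ℂ] Matrix (Fin 2) (Fin 2) ℂ,
      Φ 1 = 1 → IsCompletelyPositive Φ →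
      ∀ A : Matrix (Fin 3) (Fin 3) ℂ, A.PosDef →
        (Matrix.rpowH (Φ (Matrix.rpowH A q)) (1 / q) -
          Matrix.rpowH (Φ (Matrix.rpowH A p)) (1 / p)).PosSemidef) : FO p q := by
  intro a b c ha hb hc hab
  obtain ⟨X, Y, Z, hX0, hY0, hZ0, hX, hY, hZ, hev⟩ := curve_expansion q a b c hq ha hb hab
  obtain ⟨X', Y', Z', hX0', hY0', hZ0', hX', hY', hZ', hev'⟩ := curve_expansion p a b c hp ha hb hab
  have tX := tendsto_div_of_deriv (f := fun ε => X ε - X' ε) (by simp [hX0, hX0']) (hX.sub hX')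
  have tY := tendsto_div_of_deriv (f := fun ε => Y ε - Y' ε) (by simp [hY0, hY0']) (hY.sub hY')
  have tZ := tendsto_div_of_deriv (f := fun ε => Z ε - Z' ε) (by simp [hZ0, hZ0']) (hZ.sub hZ')
  have hps : ∀ᶠ ε in 𝓝[>] (0:ℝ), 0 < ε ∧ 0 ≤ X ε - X' ε ∧
      (Y ε - Y' ε) ^ 2 ≤ (X ε - X' ε) * (Z ε - Z' ε) := by
    have h1 : ∀ᶠ ε : ℝ in 𝓝[>] 0, ε < 1 / 2 :=
      nhdsWithin_le_nhds (eventually_lt_nhds (by norm_num))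
    filter_upwards [self_mem_nhdsWithin, h1, nhdsWithin_le_nhds hev, nhdsWithin_le_nhds hev']
      with ε he he2 e1 e2
    have := povm_ineq h a b c ε ha hb hc he he2
    rw [e1, e2] at this
    have e3 : sym2 (X ε) (Y ε) (Z ε) - sym2 (X' ε) (Y' ε) (Z' ε) =
        sym2 (X ε - X' ε) (Y ε - Y' ε) (Z ε - Z' ε) := by
      ext i j
      fin_cases i <;> fin_cases j <;> simp [sym2]
    rw [e3, sym2_posSemidef_iff] at this
    exact ⟨he, this.1, this.2.2⟩
  constructor
  · refine ge_of_tendsto tX ?_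
    filter_upwards [hps] with ε he
    exact div_nonneg he.2.1 he.1.le
  · refine le_of_tendsto_of_tendsto (tY.pow 2) (tX.mul tZ) ?_
    filter_upwards [hps] with ε he
    show ((Y ε - Y' ε) / ε) ^ 2 ≤ (X ε - X' ε) / ε * ((Z ε - Z' ε) / ε)
    rw [div_pow, div_mul_div_comm, ← sq]
    have := he.1
    gcongr
    exact he.2.2

/-- If `p, q` are nonzero reals such that `Φ(A^p)^(1/p) ≤ Φ(A^q)^(1/q)` holds for every
unital completely positive linear map `Φ : M₃ → M₂` and every `3 × 3` positive definite
complex matrix `A`, then `(p, q)` satisfies condition (★). -/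
theorem starCond_of_cp_map_inequality (p q : ℝ) (hp : p ≠ 0) (hq : q ≠ 0)
    (h : ∀ Φ : Matrix (Fin 3) (Fin 3) ℂ →ₗ[ℂ] Matrix (Fin 2) (Fin 2) ℂ,
      Φ 1 = 1 → IsCompletelyPositive Φ →
      ∀ A : Matrix (Fin 3) (Fin 3) ℂ, A.PosDef →
        (Matrix.rpowH (Φ (Matrix.rpowH A q)) (1 / q) -
          Matrix.rpowH (Φ (Matrix.rpowH A p)) (1 / p)).PosSemidef) :
    StarCond p q := by
  exact (FO_of_h hp hq h).star hp hq
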